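/- Let n ≥ 7 be an integer, let b ∈ {1, …, n−6} be fixed, and for p = 1, …, n−b−4 let T_p = T(p, n−p−b−3, b) be the caterpillar of order n. Set r = −(n−b−1) + √(2(n−b−1)(n−b−2)) and s = (1/b)(−((b+1)(n−b) − 1) + √((b+1)(n−b−1)((2b+1)(n−1) − 2b²))). Then RE(T_{n−b−4}) ≤ RE(T_p) for every p ∈ {1, …, n−b−4}, and there exists an integer z with round(r) ≤ z ≤ round(s) and 1 ≤ z ≤ n−b−4 such that RE(T_p) ≤ RE(T_z) for every p ∈ {1, …, n−b−4}. -/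

import Mathlib

open Polynomial

open scoped Classical in
/-- The Randić matrix of a simple graph `G`: the `(u,v)` entry is `1/√(d_u d_v)` when `uv` is
an edge and `0` otherwise, where `d_v` is the degree of the vertex `v`. -/
noncomputable def randicMatrix {V : Type*} (G : SimpleGraph V) : Matrix V V ℝ :=
  Matrix.of fun u v =>
    if G.Adj u v then
      1 / Real.sqrt (((G.neighborSet u).ncard : ℝ) * ((G.neighborSet v).ncard : ℝ))
    else 0

lemma randicMatrix_isHermitian {V : Type*} (G : SimpleGraph V) :
    (randicMatrix G).IsHermitian := by
  ext u v
  by_cases h : G.Adj u v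
  · simp [randicMatrix, Matrix.conjTranspose_apply, h, h.symm, mul_comm]
  · have h' : ¬ G.Adj v u := fun hc => h hc.symm
    simp [randicMatrix, Matrix.conjTranspose_apply, h, h']

/-- The Randić energy of a graph: the sum of the absolute values of the eigenvalues of its
Randić matrix. -/
noncomputable def randicEnergy {V : Type*} [Fintype V] [DecidableEq V] (G : SimpleGraph V) : ℝ :=
  ∑ i, |(randicMatrix_isHermitian G).eigenvalues i|

/-- The caterpillar `T(p 0, …, p (r-1))`: a path `v_0 v_1 ⋯ v_{r-1}` (the `Sum.inl` vertices)
together with, for each `i`, `p i` pendant vertices attached to `v_i` (the `Sum.inr` vertices). -/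
def caterpillar (r : ℕ) (p : Fin r → ℕ) :
    SimpleGraph ((Fin r) ⊕ (Σ i : Fin r, Fin (p i))) :=
  SimpleGraph.fromRel (fun u v =>
    (∃ i j : Fin r, u = Sum.inl i ∧ v = Sum.inl j ∧ (i : ℕ) + 1 = (j : ℕ)) ∨
    (∃ (i : Fin r) (k : Fin (p i)), u = Sum.inl i ∧ v = Sum.inr ⟨i, k⟩))

lemma Matrix.pow_card_mul_eval_charpoly_fromBlocks_zero {m n : Type*} [Fintype m] [Fintype n]
    [DecidableEq m] [DecidableEq n] (A : Matrix m m ℝ) (B : Matrix m n ℝ) (C : Matrix n m ℝ)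
    {t : ℝ} (ht : t ≠ 0) :
    t ^ Fintype.card m * (Matrix.fromBlocks A B C 0).charpoly.eval t =
      t ^ Fintype.card n * (t ^ 2 • (1 : Matrix m m ℝ) - t • A - B * C).det := by
  have hD : Matrix.scalar (m ⊕ n) t - Matrix.fromBlocks A B C 0 =
      Matrix.fromBlocks (t • (1 : Matrix m m ℝ) - A) (-B) (-C) (t • (1 : Matrix n n ℝ)) := by
    ext i j
    rcases i with i | i <;> rcases j with j | j <;>
      simp [Matrix.scalar_apply, Matrix.diagonal_apply, Matrix.one_apply]
  let _ : Invertible (t • (1 : Matrix n n ℝ)) :=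
    ⟨t⁻¹ • 1, by simp [smul_smul, ht], by simp [smul_smul, ht]⟩
  have hinv : ⅟(t • (1 : Matrix n n ℝ)) = t⁻¹ • 1 := rfl
  rw [Matrix.eval_charpoly, hD, Matrix.det_fromBlocks₂₂, hinv, Matrix.det_smul, Matrix.det_one,
    mul_one, mul_left_comm, ← Matrix.det_smul]
  congr 2
  simp [smul_sub, smul_smul, pow_two, ht]

section Adjacency

variable {r : ℕ} {p : Fin r → ℕ}

lemma caterpillar_adj_inl_inl (i j : Fin r) :
    (caterpillar r p).Adj (Sum.inl i) (Sum.inl j) ↔ (i : ℕ) + 1 = j ∨ (j : ℕ) + 1 = i := by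
  have h : (i : ℕ) + 1 = j ∨ (j : ℕ) + 1 = i → i ≠ j := by
    rintro h rfl
    omega
  simpa [caterpillar, SimpleGraph.fromRel_adj] using h

lemma caterpillar_adj_inl_inr (i : Fin r) (s : Σ i : Fin r, Fin (p i)) :
    (caterpillar r p).Adj (Sum.inl i) (Sum.inr s) ↔ s.1 = i := by
  obtain ⟨j, k⟩ := s
  simp only [caterpillar, SimpleGraph.fromRel_adj]
  constructor
  · rintro ⟨-, h⟩
    simp at h
    tauto
  · rintro rfl
    simp

lemma caterpillar_adj_inr_inr (s s' : Σ i : Fin r, Fin (p i)) :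
    ¬ (caterpillar r p).Adj (Sum.inr s) (Sum.inr s') := by
  simp [caterpillar, SimpleGraph.fromRel_adj]

lemma ncard_neighborSet_caterpillar_inr (s : Σ i : Fin r, Fin (p i)) :
    ((caterpillar r p).neighborSet (Sum.inr s)).ncard = 1 := by
  rw [Set.ncard_eq_one]
  refine ⟨Sum.inl s.1, ?_⟩
  ext v
  rw [SimpleGraph.mem_neighborSet]
  rcases v with j | s'
  · rw [SimpleGraph.adj_comm, caterpillar_adj_inl_inr]
    simp [eq_comm]
  · simp [caterpillar_adj_inr_inr]

lemma ncard_neighborSet_caterpillar_inl (i : Fin r) :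
    ((caterpillar r p).neighborSet (Sum.inl i)).ncard =
      (Finset.univ.filter fun j : Fin r => (i : ℕ) + 1 = j ∨ (j : ℕ) + 1 = i).card + p i := by
  have h : (caterpillar r p).neighborSet (Sum.inl i) =
      (((Finset.univ.filter fun j : Fin r => (i : ℕ) + 1 = j ∨ (j : ℕ) + 1 = i).disjSum
        ((Finset.univ : Finset (Fin (p i))).map (Function.Embedding.sigmaMk i)) :
          Finset (Fin r ⊕ (Σ i : Fin r, Fin (p i)))) : Set (Fin r ⊕ (Σ i : Fin r, Fin (p i)))) := by
    ext v
    rw [SimpleGraph.mem_neighborSet]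
    rcases v with j | ⟨j, k⟩
    · simp [caterpillar_adj_inl_inl]
    · rw [caterpillar_adj_inl_inr]
      constructor
      · rintro rfl
        simp
      · intro h
        simp at h
        exact h.1.symm
  rw [h, Set.ncard_coe_finset, Finset.card_disjSum, Finset.card_map, Finset.card_univ,
    Fintype.card_fin]

end Adjacency

/-- The Randić matrix of a caterpillar restricted to the vertices of its path. -/
noncomputable def caterpillarSpine (r : ℕ) (d : Fin r → ℕ) : Matrix (Fin r) (Fin r) ℝ :=
  Matrix.of fun i j =>
    if (i : ℕ) + 1 = j ∨ (j : ℕ) + 1 = i then 1 / √((d i : ℝ) * d j) else 0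

/-- The block of the Randić matrix of a caterpillar that joins path vertices to pendant ones. -/
noncomputable def caterpillarLegs (r : ℕ) (p d : Fin r → ℕ) :
    Matrix (Fin r) (Σ i : Fin r, Fin (p i)) ℝ :=
  Matrix.of fun i s => if s.1 = i then 1 / √(d i : ℝ) else 0

lemma randicMatrix_caterpillar {r : ℕ} {p d : Fin r → ℕ}
    (hd : ∀ i, ((caterpillar r p).neighborSet (Sum.inl i)).ncard = d i) :
    randicMatrix (caterpillar r p) = Matrix.fromBlocks (caterpillarSpine r d)
      (caterpillarLegs r p d) (caterpillarLegs r p d).transpose 0 := by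
  ext u v
  rcases u with i | s <;> rcases v with j | s'
  · simp [randicMatrix, caterpillarSpine, hd, caterpillar_adj_inl_inl]
  · simp [randicMatrix, caterpillarLegs, hd, caterpillar_adj_inl_inr,
      ncard_neighborSet_caterpillar_inr]
  · simp [randicMatrix, caterpillarLegs, hd, (caterpillar r p).adj_comm (Sum.inr s),
      caterpillar_adj_inl_inr, ncard_neighborSet_caterpillar_inr]
  · simp [randicMatrix, caterpillar_adj_inr_inr]

lemma caterpillarLegs_mul_transpose (r : ℕ) (p d : Fin r → ℕ) :
    caterpillarLegs r p d * (caterpillarLegs r p d).transpose =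
      Matrix.diagonal fun i => (p i : ℝ) / d i := by
  ext i j
  rw [Matrix.mul_apply, Fintype.sum_sigma]
  rcases eq_or_ne i j with rfl | h
  · simp [caterpillarLegs, div_eq_mul_inv, ← mul_inv]
  · simp [caterpillarLegs, h, h.symm]

lemma randicEnergy_eq_sum_roots {V : Type*} [Fintype V] [DecidableEq V] (G : SimpleGraph V) :
    randicEnergy G = ((randicMatrix G).charpoly.roots.map fun x => |x|).sum := by
  rw [(randicMatrix_isHermitian G).roots_charpoly_eq_eigenvalues]
  rw [Multiset.map_map]
  rfl

lemma eval_charpoly_randicMatrix_caterpillar_three (p q b : ℕ) (t : ℝ) :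
    t ^ 3 * (randicMatrix (caterpillar 3 ![p, q, b])).charpoly.eval t =
      t ^ (p + q + b) * ((t ^ 2 - 1) * (t ^ 4 -
        (1 - 1 / (q + 2 : ℝ)) * (p / (p + 1 : ℝ) + b / (b + 1 : ℝ)) * t ^ 2 +
        p / (p + 1 : ℝ) * (b / (b + 1 : ℝ)) * (q / (q + 2 : ℝ)))) := by
  rcases eq_or_ne t 0 with rfl | ht
  · by_cases h : p + q + b = 0
    · have : p = 0 := by omega
      subst this
      simp
    · rw [zero_pow h]
      simp
  have hd : ∀ i, ((caterpillar 3 ![p, q, b]).neighborSet (Sum.inl i)).ncard =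
      ![p + 1, q + 2, b + 1] i := by
    intro i
    rw [ncard_neighborSet_caterpillar_inl]
    fin_cases i
    · have : (Finset.univ.filter fun j : Fin 3 =>
          ((0 : Fin 3) : ℕ) + 1 = j ∨ (j : ℕ) + 1 = (0 : Fin 3)).card = 1 := by decide
      simpa [add_comm] using this
    · have : (Finset.univ.filter fun j : Fin 3 =>
          ((1 : Fin 3) : ℕ) + 1 = j ∨ (j : ℕ) + 1 = (1 : Fin 3)).card = 2 := by decide
      simpa [add_comm] using this
    · have : (Finset.univ.filter fun j : Fin 3 =>
          ((2 : Fin 3) : ℕ) + 1 = j ∨ (j : ℕ) + 1 = (2 : Fin 3)).card = 1 := by decide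
      simpa [add_comm] using this
  have h := Matrix.pow_card_mul_eval_charpoly_fromBlocks_zero
    (caterpillarSpine 3 ![p + 1, q + 2, b + 1])
    (caterpillarLegs 3 ![p, q, b] ![p + 1, q + 2, b + 1])
    (caterpillarLegs 3 ![p, q, b] ![p + 1, q + 2, b + 1]).transpose ht
  rw [caterpillarLegs_mul_transpose, ← randicMatrix_caterpillar hd] at h
  simp only [Fintype.card_fin, Fintype.card_sigma, Fin.sum_univ_three] at h
  refine h.trans ?_
  congr 1
  rw [Matrix.det_fin_three]
  simp [caterpillarSpine]
  have hx : (0 : ℝ) < p + 1 := by positivity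
  have hy : (0 : ℝ) < q + 2 := by positivity
  have hz : (0 : ℝ) < b + 1 := by positivity
  have hinv : ∀ a : ℝ, 0 < a → (√a)⁻¹ ^ 2 = a⁻¹ := fun a ha => by
    rw [inv_pow, Real.sq_sqrt ha.le]
  trans (t ^ 2 - p / (p + 1 : ℝ)) * (t ^ 2 - q / (q + 2 : ℝ)) * (t ^ 2 - b / (b + 1 : ℝ)) -
    (t ^ 2 - p / (p + 1 : ℝ)) * t ^ 2 * ((b + 1 : ℝ)⁻¹ * (q + 2 : ℝ)⁻¹) -
    (t ^ 2 - b / (b + 1 : ℝ)) * t ^ 2 * ((p + 1 : ℝ)⁻¹ * (q + 2 : ℝ)⁻¹)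
  · rw [← hinv _ hx, ← hinv _ hy, ← hinv _ hz]
    ring
  · field_simp
    ring

/-- A spectrum consisting of zeros, `± 1`, `± σ` and `± τ` is read off the characteristic
polynomial up to powers of `X`. -/
lemma sum_abs_roots_of_pow_mul_eval {f : ℝ[X]} (hf : f ≠ 0) {k l : ℕ} {σ τ : ℝ} (hσ : 0 ≤ σ)
    (hτ : 0 ≤ τ) (h : ∀ t, t ^ k * f.eval t =
      t ^ l * ((t ^ 2 - 1) * (t ^ 4 - (σ ^ 2 + τ ^ 2) * t ^ 2 + (σ * τ) ^ 2))) :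
    (f.roots.map fun x => |x|).sum = 2 * (1 + (σ + τ)) := by
  set s : Multiset ℝ := {1, -1, σ, -σ, τ, -τ} with hs
  have hpoly : X ^ k * f = X ^ l * (s.map fun a => X - C a).prod := by
    refine Polynomial.funext fun t => ?_
    simp [h, hs]
    left
    ring
  have hmon : (s.map fun a => (X - C a : ℝ[X])).prod ≠ 0 :=
    (monic_multiset_prod_of_monic _ _ fun a _ => monic_X_sub_C a).ne_zero
  have hroots := congrArg (fun g : ℝ[X] => (g.roots.map fun x => |x|).sum) hpoly
  rw [roots_mul (mul_ne_zero (pow_ne_zero _ X_ne_zero) hf),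
    roots_mul (mul_ne_zero (pow_ne_zero _ X_ne_zero) hmon), roots_multiset_prod_X_sub_C] at hroots
  simp [hs, abs_of_nonneg hσ, abs_of_nonneg hτ, Multiset.map_nsmul, Multiset.sum_nsmul]
    at hroots
  linarith

lemma exists_nonneg_sq_add_sq_eq {S P : ℝ} (hS : 0 ≤ S) (hP : 0 ≤ P) (h : 4 * P ≤ S ^ 2) :
    ∃ σ τ : ℝ, 0 ≤ σ ∧ 0 ≤ τ ∧ σ ^ 2 + τ ^ 2 = S ∧ (σ * τ) ^ 2 = P ∧
      σ + τ = √(S + 2 * √P) := by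
  have hm : 2 * √P ≤ S := by
    refine abs_le_of_sq_le_sq' ?_ hS |>.2
    rw [mul_pow, Real.sq_sqrt hP]
    linarith
  have hP0 := Real.sqrt_nonneg P
  have h1 := Real.sq_sqrt (by linarith : 0 ≤ S + 2 * √P)
  have h2 := Real.sq_sqrt (by linarith : 0 ≤ S - 2 * √P)
  have h12 : √(S - 2 * √P) ≤ √(S + 2 * √P) := Real.sqrt_le_sqrt (by linarith)
  have h3 := Real.sqrt_nonneg (S - 2 * √P)
  refine ⟨(√(S + 2 * √P) + √(S - 2 * √P)) / 2, (√(S + 2 * √P) - √(S - 2 * √P)) / 2,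
    by linarith, by linarith, by linear_combination (h1 + h2) / 2, ?_, by ring⟩
  have : (√(S + 2 * √P) + √(S - 2 * √P)) / 2 * ((√(S + 2 * √P) - √(S - 2 * √P)) / 2) = √P := by
    linear_combination (h1 - h2) / 4
  rw [this, Real.sq_sqrt hP]

lemma randicEnergy_caterpillar_three (p q b : ℕ) :
    randicEnergy (caterpillar 3 ![p, q, b]) =
      2 * (1 + √((1 - 1 / (q + 2 : ℝ)) * (p / (p + 1 : ℝ) + b / (b + 1 : ℝ)) +
        2 * √(p / (p + 1 : ℝ) * (b / (b + 1 : ℝ)) * (q / (q + 2 : ℝ))))) := by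
  have hj : 0 ≤ 1 - 1 / (q + 2 : ℝ) := by
    rw [sub_nonneg, div_le_one (by positivity)]
    linarith [(q.cast_nonneg : (0 : ℝ) ≤ q)]
  have hq : (q / (q + 2 : ℝ)) ≤ (1 - 1 / (q + 2 : ℝ)) ^ 2 := by
    have : (q / (q + 2 : ℝ)) = 1 - 2 * (1 / (q + 2 : ℝ)) := by
      field_simp
      ring
    rw [this]
    nlinarith [sq_nonneg (1 / (q + 2 : ℝ))]
  have hu : 0 ≤ p / (p + 1 : ℝ) := by positivity
  have hv : 0 ≤ b / (b + 1 : ℝ) := by positivity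
  obtain ⟨σ, τ, hσ, hτ, hS, hP, hsum⟩ := exists_nonneg_sq_add_sq_eq
    (S := (1 - 1 / (q + 2 : ℝ)) * (p / (p + 1 : ℝ) + b / (b + 1 : ℝ)))
    (P := p / (p + 1 : ℝ) * (b / (b + 1 : ℝ)) * (q / (q + 2 : ℝ)))
    (mul_nonneg hj (add_nonneg hu hv)) (by positivity) (by
      rw [mul_pow]
      nlinarith [mul_le_mul_of_nonneg_left hq (mul_nonneg hu hv),
        mul_nonneg (sq_nonneg (1 - 1 / (q + 2 : ℝ)))
          (sq_nonneg (p / (p + 1 : ℝ) - b / (b + 1 : ℝ)))])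
  rw [randicEnergy_eq_sum_roots, ← hsum]
  refine sum_abs_roots_of_pow_mul_eval (k := 3) (l := p + q + b)
    (Matrix.charpoly_monic _).ne_zero hσ hτ fun t => ?_
  rw [hS, hP]
  exact eval_charpoly_randicMatrix_caterpillar_three p q b t

/-- The sum of the square roots of the two eigenvalues other than `1` of the squared Randić matrix
of `T(x - 1, N - x - 2, b)` is the square root of this quantity. -/
noncomputable def caterpillarGap (N b x : ℝ) : ℝ :=
  (1 - 1 / (N - x)) * ((x - 1) / x + b / (b + 1)) +
    2 * √((x - 1) / x * (b / (b + 1)) * ((N - x - 2) / (N - x)))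

lemma caterpillarGap_eq {N b x : ℝ} (hb : 0 ≤ b) (hx : 0 < x) (hxN : x < N) :
    caterpillarGap N b x = 2 - 1 / (b + 1) -
      ((b + 1) * (N - 1) + b * x) / (x * (N - x)) / (b + 1) +
      2 * (√(b / (b + 1)) * √(1 - (N - 2 + x) / (x * (N - x)))) := by
  have hy : 0 < N - x := sub_pos.2 hxN
  have hc : 0 < b + 1 := by positivity
  rw [← Real.sqrt_mul (by positivity), caterpillarGap]
  congr 1
  · field_simp
    ring
  · congr 2
    field_simp
    ring

lemma add_mul_div_sub_add_mul_div (α β : ℝ) {N u v : ℝ} (hu : 0 < u) (huv : u < v) (hv : v < N) :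
    (α + β * v) / (v * (N - v)) - (α + β * u) / (u * (N - u)) =
      (v - u) / (u * v * (N - u) * (N - v)) * (α * (u + v - N) + β * (u * v)) := by
  have hv0 : 0 < v := hu.trans huv
  have hyu : 0 < N - u := by linarith
  have hyv : 0 < N - v := by linarith
  field_simp
  ring

lemma caterpillarGap_le_of_sqrt_add_le {N b u v k : ℝ} (hb : 0 ≤ b) (hu0 : 0 < u) (huv : u < v)
    (hvN : v < N) (hk : 0 < k)
    (hk' : √(1 - (N - 2 + u) / (u * (N - u))) + √(1 - (N - 2 + v) / (v * (N - v))) ≤ k)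
    (hBu : 0 ≤ 1 - (N - 2 + u) / (u * (N - u))) (hBv : 0 ≤ 1 - (N - 2 + v) / (v * (N - v)))
    (hB : 0 ≤ (N - 2) * (u + v - N) + u * v)
    (hAB : 0 ≤ ((b + 1) * (N - 1) * (u + v - N) + b * (u * v)) / (b + 1) +
      2 * √(b / (b + 1)) * (((N - 2) * (u + v - N) + u * v) / k)) :
    caterpillarGap N b v ≤ caterpillarGap N b u := by
  rw [caterpillarGap_eq hb hu0 (huv.trans hvN), caterpillarGap_eq hb (hu0.trans huv) hvN]
  have hv0 : 0 < v := hu0.trans huv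
  have hyu : 0 < N - u := by linarith
  have hyv : 0 < N - v := by linarith
  have hw0 : 0 < (v - u) / (u * v * (N - u) * (N - v)) := div_pos (by linarith) (by positivity)
  have hA' := add_mul_div_sub_add_mul_div ((b + 1) * (N - 1)) b hu0 huv hvN
  have hB' := add_mul_div_sub_add_mul_div (N - 2) 1 hu0 huv hvN
  simp only [one_mul] at hB'
  set w := (v - u) / (u * v * (N - u) * (N - v))
  have hsu := Real.sq_sqrt hBu
  have hsv := Real.sq_sqrt hBv
  have hsu0 := Real.sqrt_nonneg (1 - (N - 2 + u) / (u * (N - u)))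
  have hsv0 := Real.sqrt_nonneg (1 - (N - 2 + v) / (v * (N - v)))
  have hle : √(1 - (N - 2 + v) / (v * (N - v))) ≤ √(1 - (N - 2 + u) / (u * (N - u))) := by
    apply Real.sqrt_le_sqrt
    have := mul_nonneg hw0.le hB
    linarith
  set su := √(1 - (N - 2 + u) / (u * (N - u)))
  set sv := √(1 - (N - 2 + v) / (v * (N - v)))
  have hs : w * (((N - 2) * (u + v - N) + u * v) / k) ≤ su - sv := by
    rw [← mul_div_assoc, div_le_iff₀ hk]
    nlinarith [mul_le_mul_of_nonneg_left hk' (sub_nonneg.2 hle)]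
  have he := mul_le_mul_of_nonneg_left hs (Real.sqrt_nonneg (b / (b + 1)))
  have h := mul_nonneg hw0.le hAB
  have hA'' : ((b + 1) * (N - 1) + b * v) / (v * (N - v)) / (b + 1) -
      ((b + 1) * (N - 1) + b * u) / (u * (N - u)) / (b + 1) =
      w * (((b + 1) * (N - 1) * (u + v - N) + b * (u * v)) / (b + 1)) := by
    rw [← sub_div, hA', mul_div_assoc]
  nlinarith

lemma one_sub_div_mem_Icc {N x : ℝ} (hx : 1 ≤ x) (hxN : x + 2 ≤ N) :
    0 ≤ 1 - (N - 2 + x) / (x * (N - x)) ∧ √(1 - (N - 2 + x) / (x * (N - x))) ≤ 1 := by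
  have hy : 0 < N - x := by linarith
  have hx0 : 0 < x := by linarith
  constructor
  · rw [sub_nonneg, div_le_one (by positivity)]
    nlinarith
  · have : 0 ≤ (N - 2 + x) / (x * (N - x)) := div_nonneg (by linarith) (by positivity)
    exact Real.sqrt_le_one.2 (by linarith)

lemma caterpillarGap_le_of_nonneg {N b u v : ℝ} (hb : 0 ≤ b) (hu : 1 ≤ u) (huv : u < v)
    (hv : v + 2 ≤ N) (hB : 0 ≤ (N - 2) * (u + v - N) + u * v)
    (hAB : 0 ≤ ((b + 1) * (N - 1) * (u + v - N) + b * (u * v)) / (b + 1) +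
      √(b / (b + 1)) * ((N - 2) * (u + v - N) + u * v)) :
    caterpillarGap N b v ≤ caterpillarGap N b u := by
  have h1 := one_sub_div_mem_Icc hu (by linarith : u + 2 ≤ N)
  have h2 := one_sub_div_mem_Icc (hu.trans huv.le) hv
  refine caterpillarGap_le_of_sqrt_add_le (k := 2) hb (by linarith) huv (by linarith) (by norm_num)
    (by linarith [h1.2, h2.2]) h1.1 h2.1 hB ?_
  linarith

lemma caterpillarGap_le_of_nonpos {N b u v : ℝ} (hb : 0 ≤ b) (hu : 1 ≤ u) (huv : u < v)
    (hv : v + 2 ≤ N) (hB : (N - 2) * (u + v - N) + u * v ≤ 0)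
    (hA : (b + 1) * (N - 1) * (u + v - N) + b * (u * v) ≤ 0) :
    caterpillarGap N b u ≤ caterpillarGap N b v := by
  have hvN : v < N := by linarith
  have hyu : 0 < N - u := by linarith
  have hyv : 0 < N - v := by linarith
  have hu0 : 0 < u := by linarith
  have hv0 : 0 < v := by linarith
  rw [caterpillarGap_eq hb hu0 (by linarith), caterpillarGap_eq hb hv0 (by linarith)]
  have hw0 : 0 < (v - u) / (u * v * (N - u) * (N - v)) := div_pos (by linarith) (by positivity)
  have hA' := add_mul_div_sub_add_mul_div ((b + 1) * (N - 1)) b hu0 huv hvN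
  have hB' := add_mul_div_sub_add_mul_div (N - 2) 1 hu0 huv hvN
  simp only [one_mul] at hB'
  set w := (v - u) / (u * v * (N - u) * (N - v))
  have hA'' := mul_nonpos_of_nonneg_of_nonpos hw0.le hA
  have hB'' := mul_nonpos_of_nonneg_of_nonpos hw0.le hB
  have hA3 : ((b + 1) * (N - 1) + b * v) / (v * (N - v)) / (b + 1) ≤
      ((b + 1) * (N - 1) + b * u) / (u * (N - u)) / (b + 1) :=
    div_le_div_of_nonneg_right (by linarith) (by linarith)
  have hB3 := mul_le_mul_of_nonneg_left (Real.sqrt_le_sqrt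
    (by linarith : 1 - (N - 2 + u) / (u * (N - u)) ≤ 1 - (N - 2 + v) / (v * (N - v))))
    (Real.sqrt_nonneg (b / (b + 1)))
  linarith

lemma caterpillarGap_sub_three_le {N b u : ℝ} (hb : 1 ≤ b) (hN : 6 ≤ N) (hu : u = 2 ∨ 3 ≤ u)
    (huN : u < N - 3) : caterpillarGap N b (N - 3) ≤ caterpillarGap N b u := by
  have hc : 0 < b + 1 := by linarith
  rcases hu with rfl | hu
  · have hval : (1 : ℝ) - (N - 2 + 2) / (2 * (N - 2)) = (N - 4) / (2 * (N - 2)) := by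
      have : N - 2 ≠ 0 := by linarith
      field_simp
      ring
    have hval' : (1 : ℝ) - (N - 2 + (N - 3)) / ((N - 3) * (N - (N - 3))) =
        (N - 4) / (3 * (N - 3)) := by
      have : N - 3 ≠ 0 := by linarith
      rw [sub_sub_cancel]
      field_simp
      ring
    have h1 : √((N - 4) / (2 * (N - 2))) ≤ 3 / 4 := by
      rw [Real.sqrt_le_left (by norm_num), div_le_iff₀ (by linarith)]
      linarith
    have h2 : √((N - 4) / (3 * (N - 3))) ≤ 7 / 12 := by
      rw [Real.sqrt_le_left (by norm_num), div_le_iff₀ (by linarith)]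
      linarith
    have he : (b + 1 / 3) / (b + 1) ≤ √(b / (b + 1)) := by
      apply Real.le_sqrt_of_sq_le
      rw [div_pow, div_le_div_iff₀ (by positivity) hc]
      nlinarith
    refine caterpillarGap_le_of_sqrt_add_le (k := 4 / 3) (by linarith) (by norm_num) huN
      (by linarith) (by norm_num) ?_ ?_ ?_ (by linarith) ?_
    · rw [hval, hval']
      linarith
    · rw [hval]
      exact div_nonneg (by linarith) (by linarith)
    · rw [hval']
      exact div_nonneg (by linarith) (by linarith)
    · have hB : (N - 2) * (2 + (N - 3) - N) + 2 * (N - 3) = N - 4 := by ring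
      have hA : (b + 1) * (N - 1) * (2 + (N - 3) - N) + b * (2 * (N - 3)) =
        b * (N - 5) - (N - 1) := by ring
      rw [hA, hB]
      have h3 := mul_le_mul_of_nonneg_right he (by linarith : 0 ≤ 2 * ((N - 4) / (4 / 3)))
      have h4 : 0 ≤ (b * (N - 5) - (N - 1)) / (b + 1) +
          (b + 1 / 3) / (b + 1) * (2 * ((N - 4) / (4 / 3))) := by
        rw [div_mul_eq_mul_div, ← add_div]
        apply div_nonneg _ hc.le
        nlinarith
      linarith
  · have hB : 0 ≤ (N - 2) * (u + (N - 3) - N) + u * (N - 3) := by nlinarith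
    refine caterpillarGap_le_of_nonneg (by linarith) (by linarith) huN (by linarith) hB ?_
    have hA : 0 ≤ (b + 1) * (N - 1) * (u + (N - 3) - N) + b * (u * (N - 3)) := by
      have e1 : 0 ≤ (b + 1) * (N - 1) * (u - 3) :=
        mul_nonneg (mul_nonneg hc.le (by linarith)) (by linarith)
      have e2 : 0 ≤ b * (u * (N - 3)) :=
        mul_nonneg (by linarith) (mul_nonneg (by linarith) (by linarith))
      nlinarith
    positivity

lemma caterpillarGap_succ_le_of_critical {N b X ρ σ : ℝ} (hb : 1 ≤ b) (hN : 6 ≤ N) (hX : 1 ≤ X)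
    (hXN : X + 3 ≤ N) (hρ : ρ ^ 2 + 2 * (N - 2) * ρ = (N - 2) * N)
    (hσ : b * σ ^ 2 + 2 * ((b + 1) * (N - 1)) * σ = (b + 1) * (N - 1) * N) (hρσ : ρ ≤ σ)
    (hXρ : X + 1 / 2 ≤ ρ) : caterpillarGap N b X ≤ caterpillarGap N b (X + 1) := by
  refine caterpillarGap_le_of_nonpos (by linarith) hX (by linarith) (by linarith) ?_ ?_
  · have h1 := mul_le_mul_of_nonneg_left hXρ (by linarith : 0 ≤ 2 * (N - 2))
    have h2 := pow_le_pow_left₀ (by linarith) hXρ 2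
    nlinarith
  · have hα : 0 ≤ (b + 1) * (N - 1) := mul_nonneg (by linarith) (by linarith)
    have h1 := mul_le_mul_of_nonneg_left (hXρ.trans hρσ) (by linarith : 0 ≤ 2 * ((b + 1) * (N - 1)))
    have h2 := mul_le_mul_of_nonneg_left (pow_le_pow_left₀ (by linarith) (hXρ.trans hρσ) 2)
      (by linarith : 0 ≤ b)
    linarith

lemma caterpillarGap_le_succ_of_critical {N X : ℕ} {b σ : ℝ} (hb : 1 ≤ b) (hN : 6 ≤ N) (hX : 1 ≤ X)
    (hXN : X + 3 ≤ N)
    (hσ : b * σ ^ 2 + 2 * ((b + 1) * (N - 1)) * σ = (b + 1) * (N - 1) * N) (hσ0 : 1 / 2 ≤ σ)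
    (hXσ : σ ≤ X + 1 / 2) : caterpillarGap N b (X + 1) ≤ caterpillarGap N b X := by
  have hN' : (6 : ℝ) ≤ N := by exact_mod_cast hN
  have hX' : (1 : ℝ) ≤ X := by exact_mod_cast hX
  have hXN' : (X : ℝ) + 3 ≤ N := by exact_mod_cast hXN
  have hc : 0 < b + 1 := by linarith
  obtain ⟨K, hK⟩ : ∃ K : ℤ, K = (X : ℤ) ^ 2 + (2 * ((N : ℤ) - 1) + 1) * X - ((N : ℤ) - 1) ^ 2 :=
    ⟨_, rfl⟩
  have hKr : (K : ℝ) = (X : ℝ) ^ 2 + (2 * ((N : ℝ) - 1) + 1) * X - ((N : ℝ) - 1) ^ 2 := by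
    rw [hK]
    push_cast
    ring
  have hB : ((N : ℝ) - 2) * (X + (X + 1) - N) + X * (X + 1) = K + (N - 1 - 2 * X) := by
    rw [hKr]
    ring
  have hA : (b + 1) * ((N : ℝ) - 1) * (X + (X + 1) - N) + b * (X * (X + 1)) =
      b * K - (N - 1) * (N - 1 - 2 * X) := by
    rw [hKr]
    ring
  have hα : 0 ≤ (b + 1) * ((N : ℝ) - 1) := mul_nonneg hc.le (by linarith)
  have hQ : -b / 4 ≤ b * K - ((N : ℝ) - 1) * (N - 1 - 2 * X) := by
    have h1 := mul_le_mul_of_nonneg_left hXσ (by linarith : 0 ≤ 2 * ((b + 1) * ((N : ℝ) - 1)))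
    have h2 := mul_le_mul_of_nonneg_left (pow_le_pow_left₀ (by linarith) hXσ 2)
      (by linarith : 0 ≤ b)
    rw [← hA]
    linarith
  have he : b / (b + 1) ≤ √(b / (b + 1)) := by
    apply Real.le_sqrt_of_sq_le
    rw [sq, mul_le_iff_le_one_left (by positivity), div_le_one hc]
    linarith
  rcases le_or_gt N (2 * X + 1) with hJ | hJ
  · have hJ' : (N : ℝ) ≤ 2 * X + 1 := by exact_mod_cast hJ
    have hK0 : 0 ≤ (K : ℝ) + (N - 1 - 2 * X) := by
      rw [hKr]
      nlinarith
    have hA0 : 0 ≤ b * K - ((N : ℝ) - 1) * (N - 1 - 2 * X) := by nlinarith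
    refine caterpillarGap_le_of_nonneg (by linarith) hX' (by linarith) (by linarith) ?_ ?_
    · rwa [hB]
    · rw [hA, hB]
      exact add_nonneg (div_nonneg hA0 hc.le) (mul_nonneg (Real.sqrt_nonneg _) hK0)
  · have hJ' : 2 * (X : ℝ) + 2 ≤ N := by exact_mod_cast hJ
    have hK0 : 0 ≤ K := by
      have : (-1 : ℝ) < K := by
        by_contra! hneg
        nlinarith [mul_nonneg (by linarith : (0 : ℝ) ≤ N - 1) (by linarith : 0 ≤ (N : ℝ) - 1 - 2 * X)]
      have : -1 < K := by exact_mod_cast this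
      omega
    have hK0' : (0 : ℝ) ≤ K := by exact_mod_cast hK0
    refine caterpillarGap_le_of_nonneg (by linarith) hX' (by linarith) (by linarith) ?_ ?_
    · rw [hB]
      linarith
    · rw [hA, hB]
      have h1 := mul_le_mul he (by linarith : 1 ≤ (K : ℝ) + (N - 1 - 2 * X)) zero_le_one
        (Real.sqrt_nonneg _)
      have h2 := div_le_div_of_nonneg_right hQ hc.le
      have h3 : 0 ≤ -b / 4 / (b + 1) + b / (b + 1) := by
        rw [← add_div]
        exact div_nonneg (by linarith) hc.le
      linarith

lemma exists_max_between_of_monotone_antitone {F : ℕ → ℝ} {R S m : ℕ} (hRS : R ≤ S)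
    (hup : ∀ p, 1 ≤ p → p + 1 ≤ R → F p ≤ F (p + 1))
    (hdown : ∀ p, S ≤ p → p + 1 ≤ m → F (p + 1) ≤ F p) :
    ∃ z, R ≤ z ∧ z ≤ S ∧ ∀ p, 1 ≤ p → p ≤ m → F p ≤ F z := by
  obtain ⟨z, hz, hmax⟩ := Finset.exists_max_image (Finset.Icc R S) F ⟨R, by simp [hRS]⟩
  rw [Finset.mem_Icc] at hz
  refine ⟨z, hz.1, hz.2, fun p hp hpm => ?_⟩
  rcases lt_or_ge p R with h | h
  · have hle : ∀ k, p ≤ k → k ≤ R → F p ≤ F k := fun k hk => by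
      induction k, hk using Nat.le_induction with
      | base => exact fun _ => le_rfl
      | succ k hk ih => exact fun h => (ih (by omega)).trans (hup k (by omega) h)
    exact (hle R h.le le_rfl).trans (hmax R (by simp [hRS]))
  · rcases le_or_gt p S with h' | h'
    · exact hmax p (by simp [h, h'])
    · have hle : ∀ k, S ≤ k → k ≤ m → F k ≤ F S := fun k hk => by
        induction k, hk using Nat.le_induction with
        | base => exact fun _ => le_rfl
        | succ k hk ih => exact fun h => (hdown k hk h).trans (ih (by omega))
      exact (hle p h'.le hpm).trans (hmax S (by simp [hRS]))

lemma exists_randicEnergy_caterpillar_three_eq (b : ℕ) :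
    ∃ Φ : ℝ → ℝ, Monotone Φ ∧ ∀ N p : ℕ, p + 4 ≤ N →
      randicEnergy (caterpillar 3 ![p, N + b - p - b - 3, b]) =
        Φ (caterpillarGap N b (p + 1)) := by
  refine ⟨fun x => 2 * (1 + √x), fun x y h => ?_, fun N p hp => ?_⟩
  · have := Real.sqrt_le_sqrt h
    simp only
    linarith
  · obtain ⟨q, rfl⟩ : ∃ q, N = p + 3 + q := ⟨N - p - 3, by omega⟩
    have : p + 3 + q + b - p - b - 3 = q := by omega
    rw [this, randicEnergy_caterpillar_three, caterpillarGap]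
    have h1 : ((p + 3 + q : ℕ) : ℝ) - (p + 1) = q + 2 := by
      push_cast
      ring
    rw [h1, add_sub_cancel_right, add_sub_cancel_right]

lemma exists_caterpillarGap_max {N : ℕ} {b ρ σ : ℝ} (hb : 1 ≤ b) (hN : 6 ≤ N)
    (hρ : ρ ^ 2 + 2 * (N - 2) * ρ = (N - 2) * N) (hρ0 : 0 ≤ ρ + (N - 2))
    (hσ : b * σ ^ 2 + 2 * ((b + 1) * (N - 1)) * σ = (b + 1) * (N - 1) * N)
    (hσ0 : 0 ≤ b * σ + (b + 1) * (N - 1)) :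
    ∃ z : ℕ, round (ρ - 1) ≤ (z : ℤ) ∧ (z : ℤ) ≤ round (σ - 1) ∧ 1 ≤ z ∧ z ≤ N - 4 ∧
      ∀ p : ℕ, 1 ≤ p → p ≤ N - 4 → caterpillarGap N b (p + 1) ≤ caterpillarGap N b (z + 1) := by
  have hN' : (6 : ℝ) ≤ N := by exact_mod_cast hN
  have hα : (b + 1) * 5 ≤ (b + 1) * ((N : ℝ) - 1) :=
    mul_le_mul_of_nonneg_left (by linarith) (by linarith)
  have hρ1 : 3 / 2 ≤ ρ := by
    by_contra! h
    nlinarith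
  have hρN : 0 ≤ (N : ℝ) - 2 * ρ := by
    by_contra! h
    nlinarith [sq_nonneg ρ]
  have hρσ : ρ ≤ σ := by
    by_contra! h
    have h1 : 0 ≤ ((N : ℝ) - 2 * ρ) * ((b + 1) * (N - 1) - b * (N - 2)) :=
      mul_nonneg hρN (by linarith)
    have h2 : 0 < b * (ρ - σ) := mul_pos (by linarith) (by linarith)
    have h3 : 0 < (ρ - σ) * (b * ρ + b * σ + 2 * ((b + 1) * (N - 1))) :=
      mul_pos (by linarith) (by linarith)
    have h4 : b * ρ ^ 2 + 2 * ((b + 1) * (N - 1)) * ρ - (b + 1) * (N - 1) * N =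
        -(((N : ℝ) - 2 * ρ) * ((b + 1) * (N - 1) - b * (N - 2))) := by
      linear_combination b * hρ
    linarith
  have hσN : σ ≤ N / 2 := by
    by_contra! h
    have h1 : 0 < (b + 1) * ((N : ℝ) - 1) * (2 * σ - N) := mul_pos (by linarith) (by linarith)
    have h2 : 0 ≤ b * σ ^ 2 := mul_nonneg (by linarith) (sq_nonneg σ)
    linarith
  have hR1 : (1 : ℤ) ≤ round (ρ - 1) := by
    rw [round_eq, Int.le_floor]
    push_cast
    linarith
  have hRS : round (ρ - 1) ≤ round (σ - 1) := by
    rw [round_eq, round_eq]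
    exact Int.floor_le_floor (by linarith)
  have hSm : round (σ - 1) ≤ (N : ℤ) - 4 := by
    rw [round_eq, ← Int.lt_add_one_iff, Int.floor_lt]
    push_cast
    linarith
  have hRle : (round (ρ - 1) : ℝ) ≤ ρ - 1 / 2 := by
    rw [round_eq]
    linarith [Int.floor_le (ρ - 1 + 1 / 2)]
  have hSge : σ - 3 / 2 ≤ (round (σ - 1) : ℝ) := by
    rw [round_eq]
    linarith [Int.lt_floor_add_one (σ - 1 + 1 / 2)]
  generalize round (ρ - 1) = R' at *
  generalize round (σ - 1) = S' at *
  lift R' to ℕ using by omega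
  lift S' to ℕ using by omega
  obtain ⟨z, hRz, hzS, hz⟩ := exists_max_between_of_monotone_antitone (m := N - 4)
    (F := fun p => caterpillarGap N b (p + 1)) (R := R') (S := S') (by omega)
    (fun p hp hpR => by
      have h1 : (1 : ℝ) ≤ p := by exact_mod_cast hp
      have h2 : (p : ℝ) + 1 ≤ R' := by exact_mod_cast hpR
      push_cast at hRle ⊢
      exact caterpillarGap_succ_le_of_critical hb hN' (by linarith) (by linarith) hρ hσ hρσ
        (by linarith))
    (fun p hSp hpm => by
      have h1 : (S' : ℝ) ≤ p := by exact_mod_cast hSp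
      have h2 := caterpillarGap_le_succ_of_critical (X := p + 1) hb hN (by omega) (by omega) hσ
        (by linarith) (by push_cast at hSge ⊢; linarith)
      push_cast at h2 ⊢
      exact h2)
  exact ⟨z, by exact_mod_cast hRz, by exact_mod_cast hzS, by omega, by omega, hz⟩

lemma mul_sq_add_two_mul_of_eq_div {α β N σ : ℝ} (hβ : β ≠ 0) (h : 0 ≤ α * (α + β * N))
    (hσ : σ = (-α + √(α * (α + β * N))) / β) :
    β * σ ^ 2 + 2 * α * σ = α * N ∧ 0 ≤ β * σ + α := by
  have hs : √(α * (α + β * N)) = β * σ + α := by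
    rw [hσ, mul_div_cancel₀ _ hβ]
    ring
  have hsq := Real.sq_sqrt h
  rw [hs] at hsq
  refine ⟨?_, hs ▸ Real.sqrt_nonneg _⟩
  apply mul_left_cancel₀ hβ
  linear_combination hsq

/-- Let `n ≥ 7`, `b ∈ {1, …, n-6}` be fixed and, for `p = 1, …, n-b-4`, let
`T_p = T(p, n-p-b-3, b)` be the caterpillar of order `n`.  With
`r = -(n-b-1) + √(2(n-b-1)(n-b-2))` and
`s = (1/b)(-((b+1)(n-b) - 1) + √((b+1)(n-b-1)((2b+1)(n-1) - 2b²)))`, one has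
`RE(T_{n-b-4}) ≤ RE(T_p)` for all such `p`, and there is an integer `z` with
`round r ≤ z ≤ round s`, `1 ≤ z ≤ n-b-4` and `RE(T_p) ≤ RE(T_z)` for all such `p`. -/
theorem caterpillar3_extremal_last_fixed (n b : ℕ) (hn : 7 ≤ n) (hb1 : 1 ≤ b)
    (hb2 : b ≤ n - 6) :
    (∀ p : ℕ, 1 ≤ p → p ≤ n - b - 4 →
      randicEnergy (caterpillar 3 ![n - b - 4, n - (n - b - 4) - b - 3, b])
        ≤ randicEnergy (caterpillar 3 ![p, n - p - b - 3, b])) ∧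
    ∃ z : ℕ,
      round (-((n : ℝ) - b - 1) + Real.sqrt (2 * ((n : ℝ) - b - 1) * ((n : ℝ) - b - 2)))
          ≤ (z : ℤ) ∧
      (z : ℤ) ≤ round ((1 / (b : ℝ)) *
          (-(((b : ℝ) + 1) * ((n : ℝ) - b) - 1) +
            Real.sqrt (((b : ℝ) + 1) * ((n : ℝ) - b - 1) *
              ((2 * (b : ℝ) + 1) * ((n : ℝ) - 1) - 2 * (b : ℝ) ^ 2)))) ∧
      1 ≤ z ∧ z ≤ n - b - 4 ∧
      ∀ p : ℕ, 1 ≤ p → p ≤ n - b - 4 →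
        randicEnergy (caterpillar 3 ![p, n - p - b - 3, b])
          ≤ randicEnergy (caterpillar 3 ![z, n - z - b - 3, b]) := by
  obtain ⟨N, rfl⟩ : ∃ N, n = N + b := ⟨n - b, by omega⟩
  have hN : 6 ≤ N := by omega
  have hN' : (6 : ℝ) ≤ N := by exact_mod_cast hN
  have hb' : (1 : ℝ) ≤ b := by exact_mod_cast hb1
  have hm : N + b - b - 4 = N - 4 := by omega
  obtain ⟨Φ, hΦ, hE⟩ := exists_randicEnergy_caterpillar_three_eq b
  rw [hm]
  constructor
  · intro p hp hpm
    rw [hE N p (by omega), hE N (N - 4) (by omega)]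
    apply hΦ
    have hcast : ((N - 4 : ℕ) : ℝ) + 1 = N - 3 := by
      rw [Nat.cast_sub (by omega)]
      push_cast
      ring
    rw [hcast]
    rcases hpm.eq_or_lt with rfl | hlt
    · rw [hcast]
    · refine caterpillarGap_sub_three_le hb' hN' ?_ ?_
      · rcases hp.eq_or_lt with rfl | hp
        · left
          norm_num
        · right
          have : (2 : ℝ) ≤ p := by exact_mod_cast hp
          linarith
      · have : (p : ℝ) + 5 ≤ N := by
          have : p + 5 ≤ N := by omega
          exact_mod_cast this
        linarith
  · have hα : (0 : ℝ) ≤ (b + 1) * (N - 1) := mul_nonneg (by linarith) (by linarith)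
    obtain ⟨ρ, hρ⟩ : ∃ ρ, ρ = (-((N : ℝ) - 2) + √(((N : ℝ) - 2) * (((N : ℝ) - 2) + 1 * N))) / 1 :=
      ⟨_, rfl⟩
    obtain ⟨σ, hσ⟩ : ∃ σ, σ = (-((b + 1) * ((N : ℝ) - 1)) +
      √((b + 1) * ((N : ℝ) - 1) * ((b + 1) * ((N : ℝ) - 1) + b * N))) / b := ⟨_, rfl⟩
    have er : -(((N + b : ℕ) : ℝ) - b - 1) +
        √(2 * (((N + b : ℕ) : ℝ) - b - 1) * (((N + b : ℕ) : ℝ) - b - 2)) = ρ - 1 := by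
      have e1 : 2 * (((N + b : ℕ) : ℝ) - b - 1) * (((N + b : ℕ) : ℝ) - b - 2) =
          ((N : ℝ) - 2) * (((N : ℝ) - 2) + 1 * N) := by
        push_cast
        ring
      rw [e1, hρ]
      push_cast
      ring
    have es : (1 / (b : ℝ)) * (-(((b : ℝ) + 1) * (((N + b : ℕ) : ℝ) - b) - 1) +
        √(((b : ℝ) + 1) * (((N + b : ℕ) : ℝ) - b - 1) *
          ((2 * (b : ℝ) + 1) * (((N + b : ℕ) : ℝ) - 1) - 2 * (b : ℝ) ^ 2))) = σ - 1 := by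
      have e1 : ((b : ℝ) + 1) * (((N + b : ℕ) : ℝ) - b - 1) *
          ((2 * (b : ℝ) + 1) * (((N + b : ℕ) : ℝ) - 1) - 2 * (b : ℝ) ^ 2) =
          (b + 1) * ((N : ℝ) - 1) * ((b + 1) * ((N : ℝ) - 1) + b * N) := by
        push_cast
        ring
      rw [e1, hσ, one_div, inv_mul_eq_div, div_sub_one (by positivity)]
      push_cast
      ring
    rw [er, es]
    have hρ2 := mul_sq_add_two_mul_of_eq_div one_ne_zero
      (mul_nonneg (by linarith) (by linarith)) hρ
    have hσ2 := mul_sq_add_two_mul_of_eq_div (by positivity)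
      (mul_nonneg hα (add_nonneg hα (by positivity))) hσ
    rw [one_mul, one_mul] at hρ2
    obtain ⟨z, hRz, hzS, hz1, hzm, hz⟩ :=
      exists_caterpillarGap_max hb' hN hρ2.1 hρ2.2 hσ2.1 hσ2.2
    refine ⟨z, hRz, hzS, hz1, hzm, fun p hp hpm => ?_⟩
    rw [hE N p (by omega), hE N z (by omega)]
    exact hΦ (hz p hp hpm)
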